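/- Let Δx, Δy > 0, set ω_x(x) = (1/2)(x² − Δx²/12) and ω_y(y) = (1/2)(y² − Δy²/12), and let φ(x,y) = Ū + α₂x + α₃y + α₄ω_x(x) + α₅ω_y(y) + α₆xy with arbitrary real Ū, α₂,…,α₆. Define the data: Ū_{ij} = average of φ over [−Δx/2,Δx/2]×[−Δy/2,Δy/2] (which equals Ū), Ū_{i+1,j} = average of φ over [Δx/2,3Δx/2]×[−Δy/2,Δy/2], Ū_{i,j+1} = average of φ over [−Δx/2,Δx/2]×[Δy/2,3Δy/2], U₊ = φ(Δx/2, √3Δy/6), U₋ = φ(Δx/2, −√3Δy/6), V₊ = φ(√3Δx/6, Δy/2), V₋ = φ(−√3Δx/6, Δy/2). Then the reconstruction formulas a₄ = 3[(Ū_{ij} + Ū_{i+1,j}) − (U₊ + U₋)]/Δx², a₂ = (U₊ + U₋ − 2Ū_{ij})/Δx − a₄Δx/6, a₅ = 3[(Ū_{ij} + Ū_{i,j+1}) − (V₊ + V₋)]/Δy², a₃ = (V₊ + V₋ − 2Ū_{ij})/Δy − a₅Δy/6, a₆ = √3[U₊ − U₋ + V₊ − V₋]/(ΔxΔy) − (a₂/Δy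 + a₃/Δx) recover the coefficients exactly: a₂ = α₂, a₃ = α₃, a₄ = α₄, a₅ = α₅, a₆ = α₆. -/

import Mathlib

open intervalIntegral

/-- The integral of a quadratic polynomial over an interval. -/
theorem integral_quadratic (p q r a b : ℝ) :
    ∫ x in a..b, (p + q * x + r * x ^ 2) =
      p * (b - a) + q * ((b ^ 2 - a ^ 2) / 2) + r * ((b ^ 3 - a ^ 3) / 3) := by
  rw [integral_add (Continuous.intervalIntegrable (by fun_prop) _ _)
      (Continuous.intervalIntegrable (by fun_prop) _ _),
    integral_add (Continuous.intervalIntegrable (by fun_prop) _ _)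
      (Continuous.intervalIntegrable (by fun_prop) _ _),
    integral_const_mul, integral_const_mul, integral_const, integral_id, integral_pow]
  norm_num
  ring

/-- The integral over a rectangle of a bivariate polynomial of total degree at most two. -/
theorem integral_integral_quadratic (c p q r s t a b u v : ℝ) :
    ∫ x in a..b, ∫ y in u..v, (c + p * x + q * y + r * x ^ 2 + s * y ^ 2 + t * x * y) =
      (c * (v - u) + q * ((v ^ 2 - u ^ 2) / 2) + s * ((v ^ 3 - u ^ 3) / 3)) * (b - a) +
        (p * (v - u) + t * ((v ^ 2 - u ^ 2) / 2)) * ((b ^ 2 - a ^ 2) / 2) +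
        r * (v - u) * ((b ^ 3 - a ^ 3) / 3) := by
  rw [← integral_quadratic]
  congr 1 with x
  calc
    _ = ∫ y in u..v, ((c + p * x + r * x ^ 2) + (q + t * x) * y + s * y ^ 2) := by
      congr 1 with y
      ring
    _ = _ := by
      rw [integral_quadratic]
      ring

/-- The 2D one-sided compact reconstruction formulas recover the coefficients of
a quadratic of the form `Ū + α₂x + α₃y + α₄ω_x + α₅ω_y + α₆xy` exactly from two
neighboring cell averages and four interface Gauss-point values. -/
theorem compact_2d_reconstruction_exact (Δx Δy : ℝ) (hΔx : 0 < Δx) (hΔy : 0 < Δy)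
    (Ub α₂ α₃ α₄ α₅ α₆ : ℝ) :
    let ωx : ℝ → ℝ := fun x => (1 / 2) * (x ^ 2 - Δx ^ 2 / 12)
    let ωy : ℝ → ℝ := fun y => (1 / 2) * (y ^ 2 - Δy ^ 2 / 12)
    let φ : ℝ → ℝ → ℝ := fun x y =>
      Ub + α₂ * x + α₃ * y + α₄ * ωx x + α₅ * ωy y + α₆ * x * y
    let Uij : ℝ := (1 / (Δx * Δy)) *
      ∫ x in (-Δx / 2)..(Δx / 2), ∫ y in (-Δy / 2)..(Δy / 2), φ x y
    let Uip1j : ℝ := (1 / (Δx * Δy)) *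
      ∫ x in (Δx / 2)..(3 * Δx / 2), ∫ y in (-Δy / 2)..(Δy / 2), φ x y
    let Uijp1 : ℝ := (1 / (Δx * Δy)) *
      ∫ x in (-Δx / 2)..(Δx / 2), ∫ y in (Δy / 2)..(3 * Δy / 2), φ x y
    let Up : ℝ := φ (Δx / 2) (Real.sqrt 3 * Δy / 6)
    let Um : ℝ := φ (Δx / 2) (-(Real.sqrt 3 * Δy / 6))
    let Vp : ℝ := φ (Real.sqrt 3 * Δx / 6) (Δy / 2)
    let Vm : ℝ := φ (-(Real.sqrt 3 * Δx / 6)) (Δy / 2)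
    let a₄ : ℝ := 3 * ((Uij + Uip1j) - (Up + Um)) / Δx ^ 2
    let a₂ : ℝ := (Up + Um - 2 * Uij) / Δx - a₄ * Δx / 6
    let a₅ : ℝ := 3 * ((Uij + Uijp1) - (Vp + Vm)) / Δy ^ 2
    let a₃ : ℝ := (Vp + Vm - 2 * Uij) / Δy - a₅ * Δy / 6
    let a₆ : ℝ := Real.sqrt 3 * (Up - Um + Vp - Vm) / (Δx * Δy)
      - (a₂ / Δy + a₃ / Δx)
    Uij = Ub ∧ a₂ = α₂ ∧ a₃ = α₃ ∧ a₄ = α₄ ∧ a₅ = α₅ ∧ a₆ = α₆ := by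
  intro ωx ωy φ Uij Uip1j Uijp1 Up Um Vp Vm a₄ a₂ a₅ a₃ a₆
  have hx : Δx ≠ 0 := hΔx.ne'
  have hy : Δy ≠ 0 := hΔy.ne'
  have hsqrt : Real.sqrt 3 ^ 2 = 3 := Real.sq_sqrt (by norm_num)
  have hφ : φ = fun x y => (Ub - α₄ * Δx ^ 2 / 24 - α₅ * Δy ^ 2 / 24) + α₂ * x + α₃ * y +
      α₄ / 2 * x ^ 2 + α₅ / 2 * y ^ 2 + α₆ * x * y := by
    funext x y
    simp only [φ, ωx, ωy]
    ring
  have hUij : Uij = Ub := by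
    simp only [Uij, hφ, integral_integral_quadratic]
    field_simp
    ring
  have hUip1j : Uip1j = Ub + α₂ * Δx + α₄ * Δx ^ 2 / 2 := by
    simp only [Uip1j, hφ, integral_integral_quadratic]
    field_simp
    ring
  have hUijp1 : Uijp1 = Ub + α₃ * Δy + α₅ * Δy ^ 2 / 2 := by
    simp only [Uijp1, hφ, integral_integral_quadratic]
    field_simp
    ring
  have hU_add : Up + Um = 2 * Ub + α₂ * Δx + α₄ * Δx ^ 2 / 6 := by
    simp only [Up, Um, φ, ωx, ωy]
    linear_combination α₅ * Δy ^ 2 / 36 * hsqrt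
  have hV_add : Vp + Vm = 2 * Ub + α₃ * Δy + α₅ * Δy ^ 2 / 6 := by
    simp only [Vp, Vm, φ, ωx, ωy]
    linear_combination α₄ * Δx ^ 2 / 36 * hsqrt
  have h_sub : Real.sqrt 3 * (Up - Um + Vp - Vm) = α₃ * Δy + α₂ * Δx + α₆ * Δx * Δy := by
    simp only [Up, Um, Vp, Vm, φ, ωx, ωy]
    linear_combination (α₃ * Δy + α₂ * Δx + α₆ * Δx * Δy) / 3 * hsqrt
  have ha₄ : a₄ = α₄ := by
    simp only [a₄, hUij, hUip1j, hU_add]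
    field_simp
    ring
  have ha₅ : a₅ = α₅ := by
    simp only [a₅, hUij, hUijp1, hV_add]
    field_simp
    ring
  have ha₂ : a₂ = α₂ := by
    simp only [a₂, ha₄, hUij, hU_add]
    field_simp
    ring
  have ha₃ : a₃ = α₃ := by
    simp only [a₃, ha₅, hUij, hV_add]
    field_simp
    ring
  refine ⟨hUij, ha₂, ha₃, ha₄, ha₅, ?_⟩
  simp only [a₆, ha₂, ha₃, h_sub]
  field_simp
  ring
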